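/- Let (K,|·|) be a non-Archimedean nontrivially valued field, n ≥ 2, and let ‖·‖ be a non-Archimedean norm on K^n equivalent to the maximum norm ‖·‖_∞. Then for every x₀ ∈ K^n and every r > 0, the closed ball B[x₀,r] = {x ∈ K^n : ‖x−x₀‖ ≤ r} is paradoxical using four pieces with respect to the group IA(K^n,‖·‖) of affine isometries of (K^n,‖·‖). -/

import Mathlib

/-- `v` is a non-Archimedean valuation on the field `K`: it is nonnegative, vanishes
exactly at `0`, is multiplicative, and satisfies the strong triangle inequality. -/
def IsNAVal {K : Type*} [Field K] (v : K → ℝ) : Prop :=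
  (∀ x, 0 ≤ v x) ∧ (∀ x, v x = 0 ↔ x = 0) ∧
    (∀ x y, v (x * y) = v x * v y) ∧ (∀ x y, v (x + y) ≤ max (v x) (v y))

/-- `N` is a non-Archimedean norm on the `K`-vector space `X` with respect to the
valuation `v` on `K`. -/
def IsNANorm {K : Type*} [Field K] (v : K → ℝ) {X : Type*} [AddCommGroup X] [Module K X]
    (N : X → ℝ) : Prop :=
  (∀ x, 0 ≤ N x) ∧ (∀ x, N x = 0 ↔ x = 0) ∧
    (∀ (c : K) (x : X), N (c • x) = v c * N x) ∧ (∀ x y, N (x + y) ≤ max (N x) (N y))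

/-- The maximum norm `‖x‖_∞ = max_i v (x i)` on `K^n`. -/
noncomputable def maxNorm {K : Type*} [Field K] (v : K → ℝ) {n : ℕ} (x : Fin n → K) : ℝ :=
  sSup (Set.range fun i => v (x i))

/-- `f ∈ IA(K^n, N)`: `f` is a surjective affine isometry of `(K^n, N)`. -/
def MemIA {K : Type*} [Field K] {n : ℕ} (N : (Fin n → K) → ℝ)
    (f : (Fin n → K) → Fin n → K) : Prop :=
  (∃ (A : Matrix (Fin n) (Fin n) K) (τ : Fin n → K), ∀ x, f x = A.mulVec x + τ) ∧
    Function.Surjective f ∧ ∀ x y, N (f x - f y) = N (x - y)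

/-- A nonempty set `E ⊆ X` is paradoxical using `r` pieces with respect to the
set `S` of transformations of `X`: there are `m, k ≥ 1` with `m + k = r`,
pairwise disjoint pieces `A₁, …, A_m, B₁, …, B_k ⊆ E` covering `E`, and
transformations `g i, h j ∈ S` such that the images `g i '' A i` partition `E`
and the images `h j '' B j` partition `E`. -/
def ParadoxicalUsing {X : Type*} (S : Set (X → X)) (E : Set X) (r : ℕ) : Prop :=
  ∃ (m k : ℕ), 1 ≤ m ∧ 1 ≤ k ∧ m + k = r ∧
    ∃ (A : Fin m → Set X) (B : Fin k → Set X) (g : Fin m → X → X) (h : Fin k → X → X),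
      (∀ i, g i ∈ S) ∧ (∀ j, h j ∈ S) ∧
      (∀ i, A i ⊆ E) ∧ (∀ j, B j ⊆ E) ∧
      (∀ i i', i ≠ i' → Disjoint (A i) (A i')) ∧
      (∀ j j', j ≠ j' → Disjoint (B j) (B j')) ∧
      (∀ i j, Disjoint (A i) (B j)) ∧
      ((⋃ i, A i) ∪ ⋃ j, B j) = E ∧
      (∀ i i', i ≠ i' → Disjoint (g i '' A i) (g i' '' A i')) ∧
      (⋃ i, g i '' A i) = E ∧
      (∀ j j', j ≠ j' → Disjoint (h j '' B j) (h j' '' B j')) ∧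
      (⋃ j, h j '' B j) = E


/-- half-edge action -/
def hAct {X : Type*} (g : Bool → Equiv.Perm X) (p : Bool × Bool) (x : X) : X :=
  if p.2 then g p.1 x else (g p.1).symm x

theorem hall_inj {X : Type*} (g : Bool → Equiv.Perm X) {Γ : Type*} [LinearOrder Γ]
    (h : X → Γ) (m : Γ) (hm : ∀ x, m ≤ h x)
    (c1 : ∀ x, m < h x → ∀ p q, h (hAct g p x) ≤ h x → h (hAct g q x) ≤ h x → p = q)
    (c2 : ∀ x, h x = m → ∀ p q r, h (hAct g p x) ≤ h x → h (hAct g q x) ≤ h x →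
      h (hAct g r x) ≤ h x → p ≠ q → p ≠ r → q ≠ r → False) :
    ∃ f : X × Bool → X, Function.Injective f ∧ ∀ e, f e = e.1 ∨ f e = g e.2 e.1 := by
  classical
  -- half-edge vertex
  let vx : (X × Bool) → Bool → X := fun e ε => if ε then e.1 else g e.2 e.1
  have hop : ∀ e ε, hAct g (e.2, ε) (vx e ε) = vx e (!ε) := by
    rintro ⟨x, c⟩ (_ | _) <;> simp [hAct, vx]
  have hinj : ∀ e e' ε ε', vx e ε = vx e' ε' → (e.2, ε) = (e'.2, ε') → e = e' := by
    rintro ⟨x, c⟩ ⟨x', c'⟩ ε ε' h1 h2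
    simp only [Prod.mk.injEq] at h2
    obtain ⟨rfl, rfl⟩ := h2
    cases ε <;> simpa [vx] using h1
  let low : X × Bool → Prop := fun e => h e.1 = m ∧ h (g e.2 e.1) = m
  let hi : X × Bool → Bool := fun e => if h (g e.2 e.1) ≤ h e.1 then true else false
  have hhi : ∀ e, h (vx e (!(hi e))) ≤ h (vx e (hi e)) := by
    intro e
    by_cases hc : h (g e.2 e.1) ≤ h e.1
    · simp [hi, vx, hc]
    · simp only [hi, vx, hc]; simpa using (not_le.mp hc).le
  have hhim : ∀ e, ¬ low e → m < h (vx e (hi e)) := by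
    intro e he
    by_contra hcon
    have h1 : h (vx e (hi e)) = m := le_antisymm (not_lt.mp hcon) (hm _)
    have h2 : h (vx e (!(hi e))) = m := le_antisymm ((hhi e).trans h1.le) (hm _)
    apply he
    cases hq : hi e <;> rw [hq] at h1 h2 <;> simp [vx] at h1 h2 <;> exact ⟨by assumption, by assumption⟩
  let t : X × Bool → Finset X := fun e =>
    if low e then {e.1, g e.2 e.1} else {vx e (hi e)}
  have key : ∀ s : Finset (X × Bool), s.card ≤ (s.biUnion t).card := by
    intro s
    let F2 := s.filter low
    let F1 := s.filter (fun e => ¬ low e)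
    have hs : F2.card + F1.card = s.card := Finset.card_filter_add_card_filter_not low
    let V1 := F1.image (fun e => vx e (hi e))
    let V2 := (F2 ×ˢ (Finset.univ : Finset Bool)).image (fun eε => vx eε.1 eε.2)
    have hV1 : F1.card = V1.card := by
      symm
      apply Finset.card_image_of_injOn
      intro e he e' he' hee
      have hel : ¬ low e := (Finset.mem_filter.mp he).2
      have hel' : ¬ low e' := (Finset.mem_filter.mp he').2
      simp only at hee
      have a1 := hhi e
      have a2 := hhi e'
      rw [← hop] at a1 a2
      rw [← hee] at a2
      exact hinj e e' _ _ hee (c1 _ (hhim e hel) _ _ a1 a2)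
    have hV2 : F2.card ≤ V2.card := by
      have : (F2 ×ˢ (Finset.univ : Finset Bool)).card ≤ 2 * V2.card := by
        apply Finset.card_le_mul_card_image
        intro x hx
        by_contra hcon
        rw [not_le, Finset.two_lt_card] at hcon
        obtain ⟨⟨e1, ε1⟩, h1, ⟨e2, ε2⟩, h2, ⟨e3, ε3⟩, h3, n12, n13, n23⟩ := hcon
        simp only [Finset.mem_filter, Finset.mem_product, Finset.mem_univ, and_true, F2] at h1 h2 h3
        have lowv : ∀ e ε, low e → h (vx e ε) = m := by
          rintro e (_ | _) ⟨q1, q2⟩ <;> simp [vx, q1, q2]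
        have hxm : h x = m := by rw [← h1.2]; exact lowv _ _ h1.1.2
        have step : ∀ e ε, low e → vx e ε = x → h (hAct g (e.2, ε) x) ≤ h x := by
          intro e ε he hv
          rw [← hv, hop, lowv _ _ he, lowv _ _ he]
        have ne : ∀ e ε e' ε', vx e ε = x → vx e' ε' = x → (e, ε) ≠ (e', ε') →
            (e.2, ε) ≠ (e'.2, ε') := by
          intro e ε e' ε' q1 q2 q3 q4
          apply q3
          have := hinj e e' ε ε' (q1.trans q2.symm) q4
          rw [this, (Prod.mk.inj q4).2]
        exact c2 x hxm _ _ _ (step _ _ h1.1.2 h1.2) (step _ _ h2.1.2 h2.2) (step _ _ h3.1.2 h3.2)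
          (ne _ _ _ _ h1.2 h2.2 n12) (ne _ _ _ _ h1.2 h3.2 n13) (ne _ _ _ _ h2.2 h3.2 n23)
      rw [Finset.card_product] at this
      simp at this
      omega
    have hdis : Disjoint V1 V2 := by
      rw [Finset.disjoint_left]
      intro x hx1 hx2
      simp only [V1, V2, F1, F2, Finset.mem_image, Finset.mem_filter, Finset.mem_product] at hx1 hx2
      obtain ⟨e, he, rfl⟩ := hx1
      obtain ⟨⟨e', ε⟩, he', hx⟩ := hx2
      have := hhim e he.2
      rw [← hx] at this
      obtain ⟨q1, q2⟩ := he'.1.2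
      cases ε <;> simp [vx, q1, q2] at this
    have hsub : V1 ∪ V2 ⊆ s.biUnion t := by
      intro x hx
      rw [Finset.mem_union] at hx
      rw [Finset.mem_biUnion]
      rcases hx with hx | hx
      · obtain ⟨e, he, rfl⟩ := Finset.mem_image.mp hx
        have he := Finset.mem_filter.mp he
        exact ⟨e, he.1, by simp [t, he.2]⟩
      · obtain ⟨⟨e, ε⟩, he, rfl⟩ := Finset.mem_image.mp hx
        have he := Finset.mem_filter.mp (Finset.mem_product.mp he).1
        refine ⟨e, he.1, ?_⟩
        simp only at he
        simp only [t, he.2, if_true]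
        cases ε <;> simp [vx]
    have := Finset.card_le_card hsub
    rw [Finset.card_union_of_disjoint hdis] at this
    omega
  obtain ⟨f, hf, hft⟩ := (Finset.all_card_le_biUnion_card_iff_exists_injective t).mp key
  refine ⟨f, hf, fun e => ?_⟩
  have := hft e
  by_cases hl : low e
  · simpa [t, hl] using this
  · simp only [t, hl, if_false, Finset.mem_singleton] at this
    rw [this]
    cases hi e <;> simp [vx]

theorem paradox_of {X : Type*} (g : Bool → Equiv.Perm X) (S : Set (X → X)) (E : Set X)
    (hf : ∃ f : X × Bool → X, Function.Injective f ∧ ∀ e, f e = e.1 ∨ f e = g e.2 e.1)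
    (idS : id ∈ S) (gS : ∀ c, ((g c).symm : X → X) ∈ S)
    (gE : ∀ c x, g c x ∈ E ↔ x ∈ E) : ParadoxicalUsing S E 4 := by
  obtain ⟨f, hf, hfe⟩ := hf
  obtain ⟨φ, hφ, hR⟩ := Function.Embedding.schroeder_bernstein_of_rel (f := f)
    (g := fun x : X => (x, true)) hf (fun x y h => (Prod.mk.inj h).1)
    (fun e x => x = e.1 ∨ x = g e.2 e.1) hfe (fun b => Or.inl rfl)
  let P : Bool → Set X := fun c => {x | x ∈ E ∧ φ (x, c) = x}
  let Q : Bool → Set X := fun c => {x | x ∈ E ∧ φ ((g c).symm x, c) = x ∧ (g c).symm x ≠ x}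
  have PQ : ∀ c, Disjoint (P c) (Q c) := by
    intro c
    rw [Set.disjoint_left]
    rintro x ⟨_, h1⟩ ⟨_, h2, h3⟩
    exact h3 (Prod.mk.inj (hφ.1 (h2.trans h1.symm))).1
  have hcc : ∀ y y' c c', φ (y, c) = φ (y', c') → c = c' := fun y y' c c' h =>
    (Prod.mk.inj (hφ.1 h)).2
  have D : ∀ c c', c ≠ c' → ∀ x, (x ∈ P c ∨ x ∈ Q c) → (x ∈ P c' ∨ x ∈ Q c') → False := by
    rintro c c' hne x (⟨_, h1⟩ | ⟨_, h1, _⟩) (⟨_, h2⟩ | ⟨_, h2, _⟩) <;>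
      exact hne (hcc _ _ _ _ (h1.trans h2.symm))
  have img : ∀ c, (g c).symm '' Q c = {x | x ∈ E ∧ φ (x, c) ≠ x} := by
    intro c
    ext y
    constructor
    · rintro ⟨x, ⟨hx, h1, h2⟩, rfl⟩
      refine ⟨(gE c _).mp (by simpa using hx), ?_⟩
      rw [h1]; exact h2.symm
    · rintro ⟨hy, h1⟩
      have h2 : φ (y, c) = g c y := (hR (y, c)).resolve_left h1
      refine ⟨g c y, ⟨(gE c y).mpr hy, by simpa using h2, ?_⟩, by simp⟩
      rw [h2] at h1
      simpa using h1.symm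
  have dis2 : ∀ c, Disjoint (P c) ((g c).symm '' Q c) := by
    intro c
    rw [img, Set.disjoint_left]
    rintro x ⟨_, h1⟩ ⟨_, h2⟩
    exact h2 h1
  have un2 : ∀ c, P c ∪ ((g c).symm '' Q c) = E := by
    intro c
    rw [img]
    ext x
    simp only [P, Set.mem_union, Set.mem_ofPred_eq]
    tauto
  have cov : ∀ x ∈ E, ∃ c, x ∈ P c ∨ x ∈ Q c := by
    intro x hx
    obtain ⟨⟨y, c⟩, rfl⟩ := hφ.2 x
    refine ⟨c, ?_⟩
    by_cases hy : φ (y, c) = y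
    · left
      exact ⟨hx, by rw [hy, hy]⟩
    · right
      have h2 : φ (y, c) = g c y := (hR (y, c)).resolve_left hy
      have h3 : (g c).symm (φ (y, c)) = y := by rw [h2]; simp
      refine ⟨hx, by rw [h3], by rw [h3]; exact fun h => hy h.symm⟩
  have dd : ∀ c, ∀ i i' : Fin 2, i ≠ i' → Disjoint ((![P c, Q c] : Fin 2 → Set X) i) ((![P c, Q c] : Fin 2 → Set X) i') := by
    intro c i i' hii
    fin_cases i <;> fin_cases i' <;> first | exact absurd rfl hii | exact PQ c | exact (PQ c).symm
  have dd2 : ∀ c, ∀ i i' : Fin 2, i ≠ i' →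
      Disjoint ((![id, (g c).symm] : Fin 2 → X → X) i '' (![P c, Q c] : Fin 2 → Set X) i)
        ((![id, (g c).symm] : Fin 2 → X → X) i' '' (![P c, Q c] : Fin 2 → Set X) i') := by
    intro c i i' hii
    have := dis2 c
    fin_cases i <;> fin_cases i' <;> first | exact absurd rfl hii | simpa using this | simpa using this.symm
  have sub : ∀ c, ∀ i : Fin 2, (![P c, Q c] : Fin 2 → Set X) i ⊆ E := by
    intro c i
    fin_cases i
    · exact fun x hx => hx.1
    · exact fun x hx => hx.1
  have mS : ∀ c, ∀ i : Fin 2, (![id, (g c).symm] : Fin 2 → X → X) i ∈ S := by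
    intro c i
    fin_cases i
    · exact idS
    · exact gS c
  have un : ∀ c, (⋃ i : Fin 2, (![id, (g c).symm] : Fin 2 → X → X) i '' (![P c, Q c] : Fin 2 → Set X) i) = E := by
    intro c
    rw [← un2 c]
    ext x
    simp only [Set.mem_iUnion, Fin.exists_fin_two, Set.mem_union]
    simp only [Matrix.cons_val_zero, Matrix.cons_val_one, Set.image_id]
  have mem : ∀ c x, ∀ i : Fin 2, x ∈ (![P c, Q c] : Fin 2 → Set X) i → x ∈ P c ∨ x ∈ Q c := by
    intro c x i hx
    fin_cases i
    · exact Or.inl hx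
    · exact Or.inr hx
  refine ⟨2, 2, by norm_num, by norm_num, by norm_num, ![P false, Q false], ![P true, Q true],
    ![id, (g false).symm], ![id, (g true).symm], mS _, mS _, sub _, sub _, dd _, dd _, ?_, ?_,
    dd2 _, un _, dd2 _, un _⟩
  · intro i j
    rw [Set.disjoint_left]
    intro x h1 h2
    exact D false true (by decide) x (mem _ _ _ h1) (mem _ _ _ h2)
  · apply Set.Subset.antisymm
    · exact Set.union_subset (Set.iUnion_subset (sub _)) (Set.iUnion_subset (sub _))
    · intro x hx
      obtain ⟨c, hc⟩ := cov x hx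
      cases c
      · left
        simpa [Set.mem_iUnion, Fin.exists_fin_two] using hc
      · right
        simpa [Set.mem_iUnion, Fin.exists_fin_two] using hc

theorem nav_one {K : Type*} [Field K] {v : K → ℝ} (hv : IsNAVal v) : v 1 = 1 := by
  have h := hv.2.2.1 1 1
  have h0 : v 1 ≠ 0 := fun h => one_ne_zero ((hv.2.1 1).mp h)
  rw [mul_one] at h
  exact (mul_left_cancel₀ h0 (by rw [← h, mul_one])) 

theorem nav_pow {K : Type*} [Field K] {v : K → ℝ} (hv : IsNAVal v) (x : K) (k : ℕ) :
    v (x ^ k) = v x ^ k := by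
  induction k with
  | zero => simpa using nav_one hv
  | succ k ih => rw [pow_succ, hv.2.2.1, ih, pow_succ]

theorem nav_neg {K : Type*} [Field K] {v : K → ℝ} (hv : IsNAVal v) (x : K) : v (-x) = v x := by
  have h : v (-1) * v (-1) = 1 := by rw [← hv.2.2.1]; simpa using nav_one hv
  have h1 : v (-1) = 1 := by nlinarith [hv.1 (-1)]
  rw [← neg_one_mul, hv.2.2.1, h1, one_mul]

theorem nav_inv {K : Type*} [Field K] {v : K → ℝ} (hv : IsNAVal v) (x : K) : v x⁻¹ = (v x)⁻¹ := by
  by_cases hx : x = 0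
  · subst hx
    have : v 0 = 0 := (hv.2.1 0).mpr rfl
    simp [this]
  · have h := hv.2.2.1 x⁻¹ x
    rw [inv_mul_cancel₀ hx, nav_one hv] at h
    exact eq_inv_of_mul_eq_one_left h.symm

theorem nav_add_le {K : Type*} [Field K] {v : K → ℝ} (hv : IsNAVal v) {x y : K} {b : ℝ}
    (hx : v x ≤ b) (hy : v y ≤ b) : v (x + y) ≤ b :=
  (hv.2.2.2 x y).trans (max_le hx hy)

theorem nav_sub_le {K : Type*} [Field K] {v : K → ℝ} (hv : IsNAVal v) {x y : K} {b : ℝ}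
    (hx : v x ≤ b) (hy : v y ≤ b) : v (x - y) ≤ b := by
  rw [sub_eq_add_neg]
  exact nav_add_le hv hx (by rwa [nav_neg hv])

theorem nav_one_add {K : Type*} [Field K] {v : K → ℝ} (hv : IsNAVal v) {x : K}
    (hx : v x < 1) : v (1 + x) = 1 := by
  apply le_antisymm
  · exact nav_add_le hv (nav_one hv).le hx.le
  · by_contra hcon
    rw [not_le] at hcon
    have h := hv.2.2.2 (1 + x) (-x)
    rw [add_neg_cancel_right, nav_one hv, nav_neg hv] at h
    exact absurd h (not_le.mpr (max_lt hcon hx))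

theorem nav_int {K : Type*} [Field K] {v : K → ℝ} (hv : IsNAVal v) (m : ℤ) : v (m : K) ≤ 1 := by
  have hnat : ∀ k : ℕ, v (k : K) ≤ 1 := by
    intro k
    induction k with
    | zero => simp [(hv.2.1 0).mpr rfl]
    | succ k ih => push_cast; exact nav_add_le hv ih (nav_one hv).le
  obtain ⟨k, rfl | rfl⟩ := m.eq_nat_or_neg
  · simpa using hnat k
  · push_cast; rw [nav_neg hv]; exact hnat k

open Polynomial in
theorem nav_aeval {K : Type*} [Field K] {v : K → ℝ} (hv : IsNAVal v) {c : K} (hc : v c ≤ 1)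
    (p : ℤ[X]) : v (aeval c p) ≤ 1 := by
  induction p using Polynomial.induction_on' with
  | add p q hp hq => rw [map_add]; exact nav_add_le hv hp hq
  | monomial k a =>
    rw [aeval_monomial, hv.2.2.1, nav_pow hv]
    have := nav_int hv a
    simp only [eq_intCast]
    exact mul_le_one₀ this (pow_nonneg (hv.1 _) _) (pow_le_one₀ (hv.1 _) hc)

open Polynomial in
theorem nav_exists_int {K : Type*} [Field K] {v : K → ℝ} (hv : IsNAVal v) {c : K} (hc0 : c ≠ 0)
    (hc : v c < 1) (d : ℕ) : ∀ p : ℤ[X], p.natDegree ≤ d → p.map (Int.castRingHom K) ≠ 0 →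
    aeval c p = 0 → ∃ m : ℤ, (m : K) ≠ 0 ∧ v (m : K) < 1 := by
  induction d with
  | zero =>
    intro p hd hp h
    rw [eq_C_of_natDegree_le_zero hd] at h hp
    rw [map_C] at hp
    simp only [aeval_C] at h
    rw [eq_intCast] at h
    rw [eq_intCast, h, C_0] at hp
    exact absurd rfl hp
  | succ d ih =>
    intro p hd hp h
    have e := divX_mul_X_add p
    have e2 : aeval c p.divX * c + (p.coeff 0 : K) = 0 := by
      rw [← e] at h
      simpa using h
    by_cases h0 : (p.coeff 0 : K) = 0
    · rw [h0, add_zero] at e2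
      refine ih p.divX ?_ ?_ ((mul_eq_zero.mp e2).resolve_right hc0)
      · rw [natDegree_divX_eq_natDegree_tsub_one]; omega
      · intro hz
        apply hp
        rw [← e]
        rw [Polynomial.map_add, Polynomial.map_mul, hz, map_C, eq_intCast, h0, C_0, zero_mul, zero_add]
    · refine ⟨_, h0, ?_⟩
      have : (p.coeff 0 : K) = -(aeval c p.divX * c) := by linear_combination e2
      rw [this, nav_neg hv, hv.2.2.1]
      have h1 := nav_aeval hv hc.le p.divX
      nlinarith [hv.1 c, hv.1 (aeval c p.divX)]

theorem exists_t {K : Type*} [Field K] {v : K → ℝ} (hv : IsNAVal v)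
    (hnt : ∃ c : K, c ≠ 0 ∧ v c ≠ 1) :
    ∃ t : K, v t < 1 ∧ ∃ O : ValuationSubring K, t ∉ O := by
  obtain ⟨c, hc0, hc⟩ : ∃ c : K, c ≠ 0 ∧ v c < 1 := by
    obtain ⟨c, hc0, hc⟩ := hnt
    rcases lt_or_gt_of_ne hc with h | h
    · exact ⟨c, hc0, h⟩
    · exact ⟨c⁻¹, inv_ne_zero hc0, by rw [nav_inv hv]; exact inv_lt_one_of_one_lt₀ h⟩
  suffices ∃ t : K, v t < 1 ∧ ¬ IsIntegral ℤ t by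
    obtain ⟨t, ht, hti⟩ := this
    have : t ∉ (integralClosure ℤ K).toSubring := hti
    obtain ⟨V, _, hV⟩ := Subring.exists_le_valuationSubring_of_isIntegrallyClosedIn this
    exact ⟨t, ht, V, hV⟩
  by_cases hci : IsIntegral ℤ c
  swap
  · exact ⟨c, hc, hci⟩
  obtain ⟨p, hp, hpc⟩ := hci
  obtain ⟨m, hm0, hm⟩ := nav_exists_int hv hc0 hc p.natDegree p le_rfl
    (hp.map _).ne_zero (by simpa [Polynomial.aeval_def] using hpc)
  rcases CharP.exists' K with h0 | ⟨p, hp, hchar⟩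
  · have hM : v ((m : K) ^ 2) < 1 := by
      rw [nav_pow hv]; exact pow_lt_one₀ (hv.1 _) hm (by norm_num)
    refine ⟨(m : K) ^ 2 * (1 + (m : K) ^ 2)⁻¹, ?_, ?_⟩
    · rw [hv.2.2.1, nav_inv hv, nav_one_add hv hM]; simpa using hM
    · intro hi
      have e : (m : K) ^ 2 * (1 + (m : K) ^ 2)⁻¹ =
          algebraMap ℚ K ((m : ℚ) ^ 2 * (1 + (m : ℚ) ^ 2)⁻¹) := by simp
      rw [e, isIntegral_algebraMap_iff (algebraMap ℚ K).injective,
        IsIntegrallyClosed.isIntegral_iff] at hi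
      obtain ⟨y, hy⟩ := hi
      have hm1 : m ≠ 0 := by rintro rfl; simp at hm0
      have hpos : 0 < m ^ 2 := by positivity
      have h1 : (y : ℚ) * (1 + (m : ℚ) ^ 2) = (m : ℚ) ^ 2 := by
        have : (1 + (m : ℚ) ^ 2) ≠ 0 := by positivity
        simp only [eq_intCast] at hy
        rw [hy]; field_simp
      have h2 : y * (1 + m ^ 2) = m ^ 2 := by exact_mod_cast h1
      have hy0 : 0 < y := by
        by_contra hcon
        nlinarith
      nlinarith
  · exfalso
    have := hp
    let := ZMod.algebra K p
    have e : (m : K) = algebraMap (ZMod p) K (m : ZMod p) := by simp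
    have hz : (m : ZMod p) ≠ 0 := by
      intro h; rw [e, h, map_zero] at hm0; exact hm0 rfl
    have h1 : (m : K) ^ (p - 1) = 1 := by
      rw [e, ← map_pow, ZMod.pow_card_sub_one_eq_one hz, map_one]
    have h2 := nav_pow hv (m : K) (p - 1)
    rw [h1, nav_one hv] at h2
    have h3 : v (m : K) ^ (p - 1) < 1 :=
      pow_lt_one₀ (hv.1 _) hm (by have := hp.out.two_le; omega)
    linarith

/-- The four affine functionals. -/
def psi {K : Type*} [Field K] (t : K) (p : Bool × Bool) (z : K × K) : K :=
  match p with
  | (false, true) => z.1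
  | (false, false) => z.2
  | (true, true) => z.1 + z.2 - 1
  | (true, false) => z.1 + t * z.2 - t ^ 2

/-- Height. -/
def hgt {K : Type*} [Field K] {Γ : Type*} [LinearOrderedCommGroupWithZero Γ]
    (w : Valuation K Γ) (t : K) (z : K × K) : Γ := max (max (w z.1) (w z.2)) (w t ^ 2)

section geom
variable {K : Type*} [Field K] {Γ : Type*} [LinearOrderedCommGroupWithZero Γ]
    (w : Valuation K Γ) (t : K)

theorem val_sub_lt {x y : K} {H : Γ} (hx : w x < H) (hy : w y < H) : w (x - y) < H :=
  (w.map_sub x y).trans_lt (max_lt hx hy)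

theorem le_val_mul (ht : 1 < w t) (z : K) : w z ≤ w (t * z) := by
  rw [map_mul]
  exact le_mul_of_one_le_left' ht.le

theorem psi_le (ht : 1 < w t) (p : Bool × Bool) (z : K × K) :
    w (psi t p z) ≤ w t * hgt w t z := by
  have h2 : w t ^ 2 ≤ hgt w t z := le_max_right _ _
  have ha : w z.1 ≤ hgt w t z := (le_max_left _ _).trans (le_max_left _ _)
  have hb : w z.2 ≤ hgt w t z := (le_max_right _ _).trans (le_max_left _ _)
  have hH : hgt w t z ≤ w t * hgt w t z := le_mul_of_one_le_left' ht.le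
  have h1 : (1 : Γ) ≤ w t ^ 2 := one_le_pow_of_one_le' ht.le 2
  have h0 : w (1 : K) ≤ w t * hgt w t z := by rw [map_one]; exact h1.trans (h2.trans hH)
  have hc : w (t * z.2) ≤ w t * hgt w t z := by rw [map_mul]; gcongr
  have hd : w (t ^ 2) ≤ w t * hgt w t z := by rw [map_pow]; exact h2.trans hH
  obtain ⟨_ | _, _ | _⟩ := p
  · exact hb.trans hH
  · exact ha.trans hH
  · exact (w.map_sub _ _).trans (max_le ((w.map_add _ _).trans (max_le (ha.trans hH) hc)) hd)
  · exact (w.map_sub _ _).trans (max_le ((w.map_add _ _).trans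
      (max_le (ha.trans hH) (hb.trans hH))) h0)

theorem pair_lt (ht : 1 < w t) (z : K × K) (H : Γ) (hH : w t ^ 2 < H) (p q : Bool × Bool)
    (hp : w (t * psi t p z) < H) (hq : w (t * psi t q z) < H) (hpq : p ≠ q) :
    w z.1 < H ∧ w z.2 < H := by
  have hp' := (le_val_mul w t ht _).trans_lt hp
  have hq' := (le_val_mul w t ht _).trans_lt hq
  have h1 : w (1 : K) < H := by
    rw [map_one]; exact (one_le_pow_of_one_le' ht.le 2).trans_lt hH
  have h2 : w (t ^ 2) < H := by rwa [map_pow]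
  have c1 : ∀ x1 y1 : K, w x1 < H → w y1 < H → w (y1 - x1 + 1) < H := fun x1 y1 a b =>
    w.map_add_lt (val_sub_lt w b a) h1
  have c2 : ∀ x1 y1 : K, w x1 < H → w y1 < H → w (y1 - x1 + t ^ 2) < H := fun x1 y1 a b =>
    w.map_add_lt (val_sub_lt w b a) h2
  have A : w z.1 < H → w (psi t (true, true) z) < H → w z.1 < H ∧ w z.2 < H := fun a b =>
    ⟨a, by
      have := c1 _ _ a b
      simp only [psi] at this
      convert this using 2; ring⟩
  have B : w z.2 < H → w (psi t (true, true) z) < H → w z.1 < H ∧ w z.2 < H := fun a b =>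
    ⟨by
      have := c1 _ _ a b
      simp only [psi] at this
      convert this using 2; ring, a⟩
  have C : w z.1 < H → w (psi t (true, false) z) < H → w z.1 < H ∧ w z.2 < H := fun a b =>
    ⟨a, by
      have := c2 _ _ a b
      simp only [psi] at this
      refine (le_val_mul w t ht _).trans_lt ?_
      convert this using 2; ring⟩
  have D : w (t * z.2) < H → w (psi t (true, false) z) < H → w z.1 < H ∧ w z.2 < H := fun a b =>
    ⟨by
      have := c2 _ _ a b
      simp only [psi] at this
      convert this using 2; ring, (le_val_mul w t ht _).trans_lt a⟩
  have F : w (psi t (true, true) z) < H → w (psi t (true, false) z) < H →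
      w z.1 < H ∧ w z.2 < H := fun a b => by
    have h3 := val_sub_lt w (c2 _ _ a b) h1
    have ht1 : w (t - 1) = w t := by
      apply Valuation.map_sub_eq_of_lt_left
      rwa [map_one]
    refine B ?_ a
    refine (le_val_mul w t ht _).trans_lt ?_
    rw [map_mul, ← ht1, ← map_mul]
    simp only [psi] at h3
    convert h3 using 2; ring
  obtain ⟨_ | _, _ | _⟩ := p <;> obtain ⟨_ | _, _ | _⟩ := q <;>
    first
    | exact absurd rfl hpq
    | exact ⟨hp', hq'⟩
    | exact ⟨hq', hp'⟩
    | exact A hp' hq'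
    | exact A hq' hp'
    | exact B hp' hq'
    | exact B hq' hp'
    | exact C hp' hq'
    | exact C hq' hp'
    | exact D hp hq'
    | exact D hq hp'
    | exact F hp' hq'
    | exact F hq' hp'

theorem triple_false (ht : 1 < w t) (z : K × K) (p q r : Bool × Bool)
    (hp : w (t * psi t p z) ≤ 1) (hq : w (t * psi t q z) ≤ 1) (hr : w (t * psi t r z) ≤ 1)
    (hpq : p ≠ q) (hpr : p ≠ r) (hqr : q ≠ r) : False := by
  have lt1 : ∀ x, w (t * x) ≤ 1 → w x < 1 := by
    intro x hx
    by_contra hcon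
    rw [not_lt] at hcon
    rw [map_mul] at hx
    have : w t ≤ w t * w x := le_mul_of_one_le_right' hcon
    exact absurd (this.trans hx) (not_le.mpr ht)
  have h12 : 1 < w t ^ 2 := one_lt_pow' ht (by norm_num)
  have ltT : ∀ x, w (t * x) ≤ 1 → w x < w t ^ 2 := fun x hx => (lt1 x hx).trans h12
  have ltT' : ∀ x, w (t * x) ≤ 1 → w (t * x) < w t ^ 2 := fun x hx => hx.trans_lt h12
  have one : w (1 : K) < w t ^ 2 := by rwa [map_one]
  have tt : w t < w t ^ 2 := by
    rw [sq]
    exact lt_mul_of_one_lt_left (zero_lt_one.trans ht) ht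
  have sq0 : ∀ x : K, w x < w t ^ 2 → x = t ^ 2 → False := by
    rintro x hx rfl
    rw [map_pow] at hx
    exact lt_irrefl _ hx
  have A : w (t * psi t (false, true) z) ≤ 1 → w (t * psi t (false, false) z) ≤ 1 →
      w (t * psi t (true, true) z) ≤ 1 → False := by
    intro a b c
    have := val_sub_lt w (w.map_add_lt (lt1 _ a) (lt1 _ b)) (lt1 _ c)
    simp only [psi] at this
    ring_nf at this
    simp at this
  have B : w (t * psi t (false, true) z) ≤ 1 → w (t * psi t (false, false) z) ≤ 1 →
      w (t * psi t (true, false) z) ≤ 1 → False := by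
    intro a b c
    refine sq0 _ (val_sub_lt w (w.map_add_lt (ltT _ a) (ltT' _ b)) (ltT _ c)) ?_
    simp only [psi]
    ring
  have C : w (t * psi t (false, true) z) ≤ 1 → w (t * psi t (true, true) z) ≤ 1 →
      w (t * psi t (true, false) z) ≤ 1 → False := by
    intro a b c
    refine sq0 _ (val_sub_lt w (w.map_add_lt (w.map_add_lt (val_sub_lt w (ltT' _ b) (ltT' _ a)) tt)
      (ltT _ a)) (ltT _ c)) ?_
    simp only [psi]
    ring
  have D : w (t * psi t (false, false) z) ≤ 1 → w (t * psi t (true, true) z) ≤ 1 →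
      w (t * psi t (true, false) z) ≤ 1 → False := by
    intro a b c
    refine sq0 _ (val_sub_lt w (w.map_add_lt (w.map_add_lt (val_sub_lt w (ltT _ b) (ltT _ a)) one)
      (ltT' _ a)) (ltT _ c)) ?_
    simp only [psi]
    ring
  obtain ⟨_ | _, _ | _⟩ := p <;> obtain ⟨_ | _, _ | _⟩ := q <;> obtain ⟨_ | _, _ | _⟩ := r <;>
    first
    | exact absurd rfl hpq
    | exact absurd rfl hpr
    | exact absurd rfl hqr
    | (first | exact A hp hq hr | exact B hp hq hr | exact C hp hq hr | exact D hp hq hr)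
    | (first | exact A hp hr hq | exact B hp hr hq | exact C hp hr hq | exact D hp hr hq)
    | (first | exact A hq hp hr | exact B hq hp hr | exact C hq hp hr | exact D hq hp hr)
    | (first | exact A hq hr hp | exact B hq hr hp | exact C hq hr hp | exact D hq hr hp)
    | (first | exact A hr hp hq | exact B hr hp hq | exact C hr hp hq | exact D hr hp hq)
    | (first | exact A hr hq hp | exact B hr hq hp | exact C hr hq hp | exact D hr hq hp)

/-- Abstract version of the ping-pong conditions. -/
theorem ping_pong (ht : 1 < w t) {X : Type*} (g : Bool → Equiv.Perm X) (ζ : X → K × K) (l : K)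
    (hl : w t ^ 4 ≤ w l)
    (hg : ∀ p x, psi t p (ζ (hAct g p x)) = l * psi t p (ζ x)) :
    ∃ f : X × Bool → X, Function.Injective f ∧ ∀ e, f e = e.1 ∨ f e = g e.2 e.1 := by
  have t0 : 0 < w t := zero_lt_one.trans ht
  have small : ∀ p x, hgt w t (ζ (hAct g p x)) ≤ hgt w t (ζ x) →
      w t ^ 2 * w (t * psi t p (ζ x)) ≤ hgt w t (ζ x) := by
    intro p x h
    have h1 := psi_le w t ht p (ζ (hAct g p x))
    rw [hg, map_mul] at h1
    have h2 : w t ^ 4 * w (psi t p (ζ x)) ≤ w t * hgt w t (ζ x) :=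
      (mul_le_mul_left hl _).trans (h1.trans (mul_le_mul_right h _))
    rw [map_mul]
    refine le_of_mul_le_mul_left ?_ t0
    rwa [← mul_assoc, ← mul_assoc, ← pow_succ', ← pow_succ]
  have h12 : 1 < w t ^ 2 := one_lt_pow' ht (by norm_num)
  refine hall_inj g (fun x => hgt w t (ζ x)) (w t ^ 2) (fun x => le_max_right _ _) ?_ ?_
  · intro x hx p q hp hq
    by_contra hpq
    have lt : ∀ p, w t ^ 2 * w (t * psi t p (ζ x)) ≤ hgt w t (ζ x) →
        w (t * psi t p (ζ x)) < hgt w t (ζ x) := by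
      intro p hp
      by_cases h0 : w (t * psi t p (ζ x)) = 0
      · rw [h0]; exact (zero_lt_one.trans h12).trans hx
      · exact (lt_mul_of_one_lt_left (zero_lt_iff.mpr h0) h12).trans_le hp
    obtain ⟨a, b⟩ := pair_lt w t ht (ζ x) _ hx p q (lt p (small p x hp)) (lt q (small q x hq)) hpq
    have : hgt w t (ζ x) < hgt w t (ζ x) := max_lt (max_lt a b) hx
    exact lt_irrefl _ this
  · intro x hx p q r hp hq hr hpq hpr hqr
    have le : ∀ p, w t ^ 2 * w (t * psi t p (ζ x)) ≤ hgt w t (ζ x) →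
        w (t * psi t p (ζ x)) ≤ 1 := by
      intro p hp
      rw [hx] at hp
      refine le_of_mul_le_mul_left ?_ (zero_lt_one.trans h12)
      rwa [mul_one]
    exact triple_false w t ht (ζ x) p q r (le p (small p x hp)) (le q (small q x hq))
      (le r (small r x hr)) hpq hpr hqr

end geom

/-- Affine maps altering only two coordinates. -/
def gen {K : Type*} [Field K] {n : ℕ} (i0 i1 : Fin n) (x₀ : Fin n → K) (α β γ α' β' γ' : K)
    (x : Fin n → K) : Fin n → K :=
  x + (Pi.single i0 (α * (x i0 - x₀ i0) + β * (x i1 - x₀ i1) + γ) +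
    Pi.single i1 (α' * (x i0 - x₀ i0) + β' * (x i1 - x₀ i1) + γ'))

section gen
variable {K : Type*} [Field K] {n : ℕ} {i0 i1 : Fin n} (h01 : i0 ≠ i1) (x₀ : Fin n → K)
  (α β γ α' β' γ' : K)

theorem gen_0 (h01 : i0 ≠ i1) (x : Fin n → K) : gen i0 i1 x₀ α β γ α' β' γ' x i0 =
    x i0 + (α * (x i0 - x₀ i0) + β * (x i1 - x₀ i1) + γ) := by
  simp [gen, h01]

theorem gen_1 (h01 : i0 ≠ i1) (x : Fin n → K) : gen i0 i1 x₀ α β γ α' β' γ' x i1 =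
    x i1 + (α' * (x i0 - x₀ i0) + β' * (x i1 - x₀ i1) + γ') := by
  simp [gen, h01.symm]

theorem gen_other (x : Fin n → K) (i : Fin n) (h0 : i ≠ i0) (h1 : i ≠ i1) :
    gen i0 i1 x₀ α β γ α' β' γ' x i = x i := by
  simp [gen, h0, h1]

theorem gen_affine : ∃ (A : Matrix (Fin n) (Fin n) K) (τ : Fin n → K),
    ∀ x, gen i0 i1 x₀ α β γ α' β' γ' x = A.mulVec x + τ := by
  let ℓ : (Fin n → K) →ₗ[K] (Fin n → K) := LinearMap.id +
    ((LinearMap.single K (fun _ => K) i0).comp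
      (α • LinearMap.proj i0 + β • LinearMap.proj i1) +
    (LinearMap.single K (fun _ => K) i1).comp
      (α' • LinearMap.proj i0 + β' • LinearMap.proj i1))
  refine ⟨LinearMap.toMatrix' ℓ, gen i0 i1 x₀ α β γ α' β' γ' 0, fun x => ?_⟩
  rw [LinearMap.toMatrix'_mulVec]
  ext i
  simp only [gen, ℓ, Pi.add_apply, LinearMap.add_apply, LinearMap.comp_apply, LinearMap.id_apply,
    LinearMap.smul_apply, LinearMap.proj_apply, LinearMap.single_apply, Pi.single_apply,
    Pi.zero_apply, smul_eq_mul]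
  split_ifs <;> ring

end gen

section norm
variable {K : Type*} [Field K] {n : ℕ}

theorem le_maxNorm (v : K → ℝ) (x : Fin n → K) (i : Fin n) : v (x i) ≤ maxNorm v x :=
  le_csSup (Set.finite_range _).bddAbove ⟨i, rfl⟩

theorem N_single_le {v : K → ℝ} (hv : IsNAVal v) {N : (Fin n → K) → ℝ} {C₂ : ℝ} (hC : 0 < C₂)
    (hN2 : ∀ x, N x ≤ C₂ * maxNorm v x) {i0 i1 : Fin n} (a b : K) (M : ℝ)
    (ha : v a ≤ M) (hb : v b ≤ M) (h01 : i0 ≠ i1) :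
    N (Pi.single i0 a + Pi.single i1 b) ≤ C₂ * M := by
  refine (hN2 _).trans ?_
  gcongr
  have : Nonempty (Fin n) := ⟨i0⟩
  refine csSup_le (Set.range_nonempty _) ?_
  rintro _ ⟨i, rfl⟩
  simp only [Pi.add_apply, Pi.single_apply]
  by_cases h0 : i = i0
  · subst h0; simpa [h01] using ha
  · by_cases h1 : i = i1
    · subst h1; simpa [h0] using hb
    · simp only [h0, h1, if_false, add_zero, (hv.2.1 0).mpr rfl]
      exact (hv.1 a).trans ha

theorem nan_neg {v : K → ℝ} (hv : IsNAVal v) {N : (Fin n → K) → ℝ} (hN : IsNANorm v N)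
    (x : Fin n → K) : N (-x) = N x := by
  have := hN.2.2.1 (-1) x
  rw [nav_neg hv, nav_one hv, one_mul] at this
  simpa using this

theorem nan_add_eq {v : K → ℝ} (hv : IsNAVal v) {N : (Fin n → K) → ℝ} (hN : IsNANorm v N)
    (x d : Fin n → K) (h : N d < N x) : N (x + d) = N x := by
  apply le_antisymm
  · exact (hN.2.2.2 x d).trans (max_le le_rfl h.le)
  · by_contra hcon
    rw [not_le] at hcon
    have h2 := hN.2.2.2 (x + d) (-d)
    rw [add_neg_cancel_right, nan_neg hv hN] at h2
    exact absurd h2 (not_le.mpr (max_lt hcon h))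

theorem gen_good {v : K → ℝ} (hv : IsNAVal v) {N : (Fin n → K) → ℝ} (hN : IsNANorm v N)
    {C₁ C₂ : ℝ} (hC1 : 0 < C₁) (hC : 0 < C₂) (hN1 : ∀ x, C₁ * maxNorm v x ≤ N x)
    (hN2 : ∀ x, N x ≤ C₂ * maxNorm v x) {i0 i1 : Fin n} (h01 : i0 ≠ i1) (x₀ : Fin n → K)
    {r ε : ℝ} (hε1 : C₂ * ε < C₁) (hε2 : C₂ * ε ≤ r) (α β γ α' β' γ' : K)
    (e1 : v α ≤ ε) (e2 : v β ≤ ε) (e3 : v γ ≤ ε) (e4 : v α' ≤ ε) (e5 : v β' ≤ ε) (e6 : v γ' ≤ ε)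
    (hs : Function.Surjective (gen i0 i1 x₀ α β γ α' β' γ')) :
    MemIA N (gen i0 i1 x₀ α β γ α' β' γ') ∧
    ∀ x, N (gen i0 i1 x₀ α β γ α' β' γ' x - x₀) ≤ r ↔ N (x - x₀) ≤ r := by
  have hε : 0 ≤ ε := (hv.1 α).trans e1
  have iso : ∀ x y, N (gen i0 i1 x₀ α β γ α' β' γ' x - gen i0 i1 x₀ α β γ α' β' γ' y) =
      N (x - y) := by
    intro x y
    by_cases hxy : x = y
    · subst hxy; simp
    have e : gen i0 i1 x₀ α β γ α' β' γ' x - gen i0 i1 x₀ α β γ α' β' γ' y = (x - y) +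
        (Pi.single i0 (α * (x - y) i0 + β * (x - y) i1) +
          Pi.single i1 (α' * (x - y) i0 + β' * (x - y) i1)) := by
      ext i
      simp only [gen, Pi.add_apply, Pi.sub_apply, Pi.single_apply]
      split_ifs <;> ring
    have bd : ∀ a b : K, v a ≤ ε → v b ≤ ε →
        v (a * (x - y) i0 + b * (x - y) i1) ≤ ε * maxNorm v (x - y) := by
      intro a b ha hb
      apply nav_add_le hv
      · rw [hv.2.2.1]; exact mul_le_mul ha (le_maxNorm v _ _) (hv.1 _) hε
      · rw [hv.2.2.1]; exact mul_le_mul hb (le_maxNorm v _ _) (hv.1 _) hε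
    rw [e]
    apply nan_add_eq hv hN
    refine (N_single_le hv hC hN2 _ _ _ (bd α β e1 e2) (bd α' β' e4 e5) h01).trans_lt ?_
    have hpos : 0 < N (x - y) :=
      lt_of_le_of_ne (hN.1 _) (fun h => hxy (sub_eq_zero.mp ((hN.2.1 _).mp h.symm)))
    have hmp : 0 < maxNorm v (x - y) := by
      by_contra hcon
      have := hN2 (x - y)
      nlinarith
    calc C₂ * (ε * maxNorm v (x - y)) = (C₂ * ε) * maxNorm v (x - y) := by ring
      _ < C₁ * maxNorm v (x - y) := by gcongr
      _ ≤ N (x - y) := hN1 _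
  have h0 : N (gen i0 i1 x₀ α β γ α' β' γ' x₀ - x₀) ≤ r := by
    have e : gen i0 i1 x₀ α β γ α' β' γ' x₀ - x₀ = Pi.single i0 γ + Pi.single i1 γ' := by
      simp [gen]
    rw [e]
    exact (N_single_le hv hC hN2 _ _ _ e3 e6 h01).trans hε2
  refine ⟨⟨gen_affine _ _ _ _ _ _ _, hs, iso⟩, fun x => ?_⟩
  constructor
  · intro h
    rw [← iso x x₀]
    have e : gen i0 i1 x₀ α β γ α' β' γ' x - gen i0 i1 x₀ α β γ α' β' γ' x₀ =
      (gen i0 i1 x₀ α β γ α' β' γ' x - x₀) + -(gen i0 i1 x₀ α β γ α' β' γ' x₀ - x₀) := by abel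
    rw [e]
    refine (hN.2.2.2 _ _).trans (max_le h ?_)
    rwa [nan_neg hv hN]
  · intro h
    have e : gen i0 i1 x₀ α β γ α' β' γ' x - x₀ =
      (gen i0 i1 x₀ α β γ α' β' γ' x - gen i0 i1 x₀ α β γ α' β' γ' x₀) +
        (gen i0 i1 x₀ α β γ α' β' γ' x₀ - x₀) := by abel
    rw [e]
    refine (hN.2.2.2 _ _).trans (max_le ?_ h0)
    rwa [iso]

/-- the diagonal map -/
def mapA (i0 i1 : Fin n) (x₀ : Fin n → K) (l : K) : (Fin n → K) → Fin n → K :=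
  gen i0 i1 x₀ (l - 1) 0 0 0 (l⁻¹ - 1) 0

/-- the skew map -/
def mapB (i0 i1 : Fin n) (x₀ : Fin n → K) (t l : K) : (Fin n → K) → Fin n → K :=
  gen i0 i1 x₀
    ((l - 1) - (t - 1)⁻¹ * ((l⁻¹ - 1) - (l - 1)))
    ((l - 1) - (t - 1)⁻¹ * (t * (l⁻¹ - 1) - (l - 1)))
    (-(l - 1) - (t - 1)⁻¹ * ((l - 1) - t ^ 2 * (l⁻¹ - 1)))
    ((t - 1)⁻¹ * ((l⁻¹ - 1) - (l - 1)))
    ((t - 1)⁻¹ * (t * (l⁻¹ - 1) - (l - 1)))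
    ((t - 1)⁻¹ * ((l - 1) - t ^ 2 * (l⁻¹ - 1)))

theorem mapA_inv {i0 i1 : Fin n} (h01 : i0 ≠ i1) (x₀ : Fin n → K) (l : K) (hl : l ≠ 0)
    (x : Fin n → K) : mapA i0 i1 x₀ l⁻¹ (mapA i0 i1 x₀ l x) = x := by
  ext i
  by_cases h0 : i = i0
  · subst h0
    simp only [mapA, gen_0 _ _ _ _ _ _ _ h01, gen_1 _ _ _ _ _ _ _ h01]
    field_simp
    ring
  by_cases h1 : i = i1
  · subst h1
    simp only [mapA, gen_0 _ _ _ _ _ _ _ h01, gen_1 _ _ _ _ _ _ _ h01]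
    field_simp
    ring
  simp only [mapA, gen_other _ _ _ _ _ _ _ _ i h0 h1]

theorem mapB_inv {i0 i1 : Fin n} (h01 : i0 ≠ i1) (x₀ : Fin n → K) (t l : K) (hl : l ≠ 0)
    (ht : t - 1 ≠ 0) (x : Fin n → K) : mapB i0 i1 x₀ t l⁻¹ (mapB i0 i1 x₀ t l x) = x := by
  ext i
  by_cases h0 : i = i0
  · subst h0
    simp only [mapB, gen_0 _ _ _ _ _ _ _ h01, gen_1 _ _ _ _ _ _ _ h01]
    field_simp
    ring
  by_cases h1 : i = i1
  · subst h1
    simp only [mapB, gen_0 _ _ _ _ _ _ _ h01, gen_1 _ _ _ _ _ _ _ h01]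
    field_simp
    ring
  simp only [mapB, gen_other _ _ _ _ _ _ _ _ i h0 h1]

/-- the two permutations -/
def gPerm {i0 i1 : Fin n} (h01 : i0 ≠ i1) (x₀ : Fin n → K) (t l : K) (hl : l ≠ 0)
    (ht : t - 1 ≠ 0) (c : Bool) : Equiv.Perm (Fin n → K) :=
  match c with
  | false => ⟨mapA i0 i1 x₀ l, mapA i0 i1 x₀ l⁻¹, mapA_inv h01 x₀ l hl, fun x => by
      simpa using mapA_inv h01 x₀ l⁻¹ (inv_ne_zero hl) x⟩
  | true => ⟨mapB i0 i1 x₀ t l, mapB i0 i1 x₀ t l⁻¹, mapB_inv h01 x₀ t l hl ht, fun x => by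
      simpa using mapB_inv h01 x₀ t l⁻¹ (inv_ne_zero hl) ht x⟩

theorem psi_act {i0 i1 : Fin n} (h01 : i0 ≠ i1) (x₀ : Fin n → K) (t l : K) (hl : l ≠ 0)
    (ht : t - 1 ≠ 0) (p : Bool × Bool) (x : Fin n → K) :
    psi t p ((hAct (gPerm h01 x₀ t l hl ht) p x) i0 - x₀ i0,
      (hAct (gPerm h01 x₀ t l hl ht) p x) i1 - x₀ i1) =
    l * psi t p (x i0 - x₀ i0, x i1 - x₀ i1) := by
  obtain ⟨_ | _, _ | _⟩ := p
  · change mapA i0 i1 x₀ l⁻¹ x i1 - x₀ i1 = l * (x i1 - x₀ i1)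
    simp only [mapA, gen_1 _ _ _ _ _ _ _ h01, inv_inv]
    ring
  · change mapA i0 i1 x₀ l x i0 - x₀ i0 = l * (x i0 - x₀ i0)
    simp only [mapA, gen_0 _ _ _ _ _ _ _ h01]
    ring
  · change (mapB i0 i1 x₀ t l⁻¹ x i0 - x₀ i0) + t * (mapB i0 i1 x₀ t l⁻¹ x i1 - x₀ i1) - t ^ 2 =
      l * ((x i0 - x₀ i0) + t * (x i1 - x₀ i1) - t ^ 2)
    simp only [mapB, gen_0 _ _ _ _ _ _ _ h01, gen_1 _ _ _ _ _ _ _ h01]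
    field_simp
    ring
  · change (mapB i0 i1 x₀ t l x i0 - x₀ i0) + (mapB i0 i1 x₀ t l x i1 - x₀ i1) - 1 =
      l * ((x i0 - x₀ i0) + (x i1 - x₀ i1) - 1)
    simp only [mapB, gen_0 _ _ _ _ _ _ _ h01, gen_1 _ _ _ _ _ _ _ h01]
    field_simp
    ring

theorem maps_good {v : K → ℝ} (hv : IsNAVal v) {N : (Fin n → K) → ℝ} (hN : IsNANorm v N)
    {C₁ C₂ : ℝ} (hC1 : 0 < C₁) (hC : 0 < C₂) (hN1 : ∀ x, C₁ * maxNorm v x ≤ N x)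
    (hN2 : ∀ x, N x ≤ C₂ * maxNorm v x) {i0 i1 : Fin n} (h01 : i0 ≠ i1) (x₀ : Fin n → K)
    {r ε : ℝ} (hε1 : C₂ * ε < C₁) (hε2 : C₂ * ε ≤ r) (t l : K) (hl : l ≠ 0) (ht : t - 1 ≠ 0)
    (hvt : v t < 1) (p1 : v (l - 1) ≤ ε) (p2 : v (l⁻¹ - 1) ≤ ε) :
    (MemIA N (mapA i0 i1 x₀ l) ∧ ∀ x, N (mapA i0 i1 x₀ l x - x₀) ≤ r ↔ N (x - x₀) ≤ r) ∧
    (MemIA N (mapB i0 i1 x₀ t l) ∧ ∀ x, N (mapB i0 i1 x₀ t l x - x₀) ≤ r ↔ N (x - x₀) ≤ r) := by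
  have hε : 0 ≤ ε := (hv.1 _).trans p1
  have z : v 0 ≤ ε := by rw [(hv.2.1 0).mpr rfl]; exact hε
  have vt1 : v (t - 1)⁻¹ = 1 := by
    rw [nav_inv hv, ← nav_neg hv, neg_sub, sub_eq_add_neg, nav_one_add hv (by rwa [nav_neg hv]),
      inv_one]
  have m1 : ∀ x, v x ≤ ε → v ((t - 1)⁻¹ * x) ≤ ε := by
    intro x hx; rw [hv.2.2.1, vt1, one_mul]; exact hx
  have m2 : ∀ x, v x ≤ ε → v (t * x) ≤ ε := by
    intro x hx; rw [hv.2.2.1]; nlinarith [hv.1 x, hv.1 t]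
  have m3 : ∀ x, v x ≤ ε → v (t ^ 2 * x) ≤ ε := by
    intro x hx; rw [sq, mul_assoc]; exact m2 _ (m2 _ hx)
  have q1 := m1 _ (nav_sub_le hv p2 p1)
  have q2 := m1 _ (nav_sub_le hv (m2 _ p2) p1)
  have q3 := m1 _ (nav_sub_le hv p1 (m3 _ p2))
  constructor
  · exact gen_good hv hN hC1 hC hN1 hN2 h01 x₀ hε1 hε2 _ _ _ _ _ _ p1 z z z p2 z
      (gPerm h01 x₀ t l hl ht false).surjective
  · exact gen_good hv hN hC1 hC hN1 hN2 h01 x₀ hε1 hε2 _ _ _ _ _ _ (nav_sub_le hv p1 q1)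
      (nav_sub_le hv p1 q2) (nav_sub_le hv (by rwa [nav_neg hv]) q3) q1 q2 q3
      (gPerm h01 x₀ t l hl ht true).surjective

end norm

theorem statement10 {K : Type*} [Field K] (v : K → ℝ) (hv : IsNAVal v)
    (hnt : ∃ c : K, c ≠ 0 ∧ v c ≠ 1)
    (n : ℕ) (hn : 2 ≤ n) (N : (Fin n → K) → ℝ) (hN : IsNANorm v N)
    -- N is equivalent to the maximum norm
    (heq : ∃ C₁ C₂ : ℝ, 0 < C₁ ∧ 0 < C₂ ∧
      ∀ x : Fin n → K, C₁ * maxNorm v x ≤ N x ∧ N x ≤ C₂ * maxNorm v x)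
    (x₀ : Fin n → K) (r : ℝ) (hr : 0 < r) :
    ParadoxicalUsing {f | MemIA N f} {x : Fin n → K | N (x - x₀) ≤ r} 4 := by

  obtain ⟨C₁, C₂, hC1, hC2, hC⟩ := heq
  obtain ⟨t, hvt, O, hO⟩ := exists_t hv hnt
  have ht : 1 < O.valuation t := by
    rw [← not_le, ValuationSubring.valuation_le_one_iff]; exact hO
  obtain ⟨k, hk⟩ := exists_pow_lt_of_lt_one (show 0 < min (min C₁ r / C₂) 1 by positivity) hvt
  set w := O.valuation with hw
  set e : ℕ := k + 4
  have hke : v (t ^ e) ≤ v t ^ k := by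
    rw [nav_pow hv]
    exact pow_le_pow_of_le_one (hv.1 _) hvt.le (by omega)
  have hε := hke.trans_lt hk
  have hε' : v (t ^ e) * C₂ < min C₁ r := by
    rw [← lt_div_iff₀ hC2]; exact hε.trans_le (min_le_left _ _)
  have hε3 : v (t ^ e) < 1 := hε.trans_le (min_le_right _ _)
  have hvl : v (1 + t ^ e) = 1 := nav_one_add hv hε3
  have hl0 : (1 + t ^ e) ≠ 0 := by
    intro h
    rw [(hv.2.1 _).mpr h] at hvl
    norm_num at hvl
  have ht1 : t - 1 ≠ 0 := by
    intro h
    rw [sub_eq_zero.mp h, map_one] at ht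
    exact lt_irrefl _ ht
  have hwl : w t ^ 4 ≤ w (1 + t ^ e) := by
    have h1 : w (1 + t ^ e) = w (t ^ e) := by
      apply Valuation.map_add_eq_of_lt_right
      rw [map_one, map_pow]
      exact one_lt_pow' ht (by omega)
    rw [h1, map_pow]
    exact pow_le_pow_right₀ ht.le (by omega)
  let i0 : Fin n := ⟨0, by omega⟩
  let i1 : Fin n := ⟨1, by omega⟩
  have h01 : i0 ≠ i1 := by simp [i0, i1]
  have p1 : v ((1 + t ^ e) - 1) ≤ v (t ^ e) := by rw [add_sub_cancel_left]
  have p2 : v ((1 + t ^ e)⁻¹ - 1) ≤ v (t ^ e) := by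
    have : (1 + t ^ e)⁻¹ - 1 = -((1 + t ^ e)⁻¹ * t ^ e) := by field_simp; ring
    rw [this, nav_neg hv, hv.2.2.1, nav_inv hv, hvl, inv_one, one_mul]
  have hε1 : C₂ * v (t ^ e) < C₁ := by
    rw [mul_comm]; exact hε'.trans_le (min_le_left _ _)
  have hε2 : C₂ * v (t ^ e) ≤ r := by
    rw [mul_comm]; exact (hε'.trans_le (min_le_right _ _)).le
  have G := maps_good hv hN hC1 hC2 (fun x => (hC x).1) (fun x => (hC x).2) h01 x₀ hε1 hε2
    t (1 + t ^ e) hl0 ht1 hvt p1 p2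
  have G' := maps_good hv hN hC1 hC2 (fun x => (hC x).1) (fun x => (hC x).2) h01 x₀ hε1 hε2
    t (1 + t ^ e)⁻¹ (inv_ne_zero hl0) ht1 hvt p2 (by rw [inv_inv]; exact p1)
  refine paradox_of (gPerm h01 x₀ t (1 + t ^ e) hl0 ht1) _ _
    (ping_pong w t ht _ (fun x => (x i0 - x₀ i0, x i1 - x₀ i1)) (1 + t ^ e) hwl
      (psi_act h01 x₀ t _ hl0 ht1)) ?_ ?_ ?_
  · exact ⟨⟨1, 0, fun x => by simp⟩, Function.surjective_id, fun x y => rfl⟩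
  · rintro (_ | _)
    · exact G'.1.1
    · exact G'.2.1
  · rintro (_ | _) x
    · exact G.1.2 x
    · exact G.2.2 x
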